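/- Let Ω⁺ ⊂ ℝ³ be a bounded open set with Lipschitz boundary, let Ω⁻ = {φ > 0} \ closure(Ω⁺) be the open representative of the minimizer of the unconstrained problem, with φ the associated potential. Then for every x ∈ Ω⁻ one has dist(x, Ω⁺) ≤ 2 |Ω⁺|^{1/3}. -/

import Mathlib

open MeasureTheory Real
open scoped RealInnerProductSpace

noncomputable section

abbrev E3 := EuclideanSpace ℝ (Fin 3)

/-- The Coulomb kernel in ℝ³. -/
def coul (x y : E3) : ℝ := 1 / (4 * π * ‖x - y‖)

/-- The Coulomb energy `E(Ω⁻)`. -/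
def energy (Ωp Ωm : Set E3) : ℝ :=
  (∫ x in Ωp, ∫ y in Ωp, coul x y) + (∫ x in Ωm, ∫ y in Ωm, coul x y)
    - 2 * ∫ x in Ωp, ∫ y in Ωm, coul x y

/-- Admissible configurations for the unconstrained problem. -/
def Adm (Ωp Ωm : Set E3) : Prop :=
  MeasurableSet Ωm ∧ volume (Ωp ∩ Ωm) = 0 ∧ volume Ωm < ⊤

/-- The potential `φ` generated by the charges `χ_{Ω⁺} − χ_{Ω⁻}`. -/
def potential (Ωp Ωm : Set E3) (x : E3) : ℝ :=
  ∫ y, (Set.indicator Ωp (fun _ => (1:ℝ)) y - Set.indicator Ωm (fun _ => (1:ℝ)) y) * coul x y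

/-- A bounded open set has Lipschitz boundary if near each boundary point, after
choosing a unit direction `ν`, the set is the region above the graph of a
Lipschitz function over the hyperplane orthogonal to `ν`. -/
def HasLipschitzBoundary (Ω : Set E3) : Prop :=
  ∀ x ∈ frontier Ω, ∃ (ν : E3) (ψ : E3 → ℝ) (K : NNReal) (r : ℝ),
    ‖ν‖ = 1 ∧ LipschitzWith K ψ ∧ 0 < r ∧
    ∀ (v : E3) (t : ℝ), ⟪v, ν⟫ = 0 → x + v + t • ν ∈ Metric.ball x r →
      (x + v + t • ν ∈ Ω ↔ ψ v < t)

theorem integral_mul_inv_sqrt_sq_add_sq {a b : ℝ} (hb : 0 ≤ b) :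
    ∫ t in (0 : ℝ)..b, t * (√(a ^ 2 + t ^ 2))⁻¹ = √(a ^ 2 + b ^ 2) - |a| := by
  have hcont : ContinuousOn (fun t : ℝ => √(a ^ 2 + t ^ 2)) (Set.Icc 0 b) := by fun_prop
  have hderiv : ∀ t ∈ Set.Ioo (0 : ℝ) b,
      HasDerivAt (fun t : ℝ => √(a ^ 2 + t ^ 2)) (t * (√(a ^ 2 + t ^ 2))⁻¹) t := by
    intro t ht
    have hpos : 0 < a ^ 2 + t ^ 2 := by have := ht.1; positivity
    have h := (((hasDerivAt_pow 2 t)).const_add (a ^ 2)).sqrt hpos.ne'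
    convert h using 1
    field_simp
    simp [mul_comm]
  rw [intervalIntegral.integral_eq_sub_of_hasDerivAt_of_le hb hcont hderiv]
  · simp [Real.sqrt_sq_eq_abs]
  · refine (intervalIntegrable_iff_integrableOn_Ioc_of_le hb).2
      (intervalIntegral.integrableOn_deriv_of_nonneg hcont hderiv fun t ht => ?_)
    have := ht.1
    positivity

theorem integral_disc_inv_sqrt (s ρ : ℝ) {R : ℝ} (hR : 0 < R) :
    ∫ z : EuclideanSpace ℝ (Fin 2),
        (if s ^ 2 + ‖z‖ ^ 2 < R ^ 2 then (√((s - ρ) ^ 2 + ‖z‖ ^ 2))⁻¹ else 0) =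
      (Set.Ioo (-R) R).indicator
        (fun s => 2 * π * (√(R ^ 2 + ρ ^ 2 - 2 * ρ * s) - |s - ρ|)) s := by
  have hvol : (volume : Measure (EuclideanSpace ℝ (Fin 2))).real (Metric.ball 0 1) = π := by
    simp [Measure.real, EuclideanSpace.volume_ball_fin_two, pi_nonneg]
  rw [integral_fun_norm_addHaar (volume : Measure (EuclideanSpace ℝ (Fin 2)))
    (fun t => if s ^ 2 + t ^ 2 < R ^ 2 then (√((s - ρ) ^ 2 + t ^ 2))⁻¹ else 0), hvol]
  simp only [finrank_euclideanSpace, Fintype.card_fin, smul_eq_mul, nsmul_eq_mul]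
  by_cases hs : s ∈ Set.Ioo (-R) R
  · rw [Set.indicator_of_mem hs]
    have hs2 : s ^ 2 < R ^ 2 := sq_lt_sq' hs.1 hs.2
    set b := √(R ^ 2 - s ^ 2) with hb
    have hb2 : b ^ 2 = R ^ 2 - s ^ 2 := Real.sq_sqrt (by linarith)
    have hb0 : 0 ≤ b := Real.sqrt_nonneg _
    have : ∫ y in Set.Ioi (0 : ℝ), y ^ (2 - 1) *
          (if s ^ 2 + y ^ 2 < R ^ 2 then (√((s - ρ) ^ 2 + y ^ 2))⁻¹ else 0) =
        ∫ t in (0 : ℝ)..b, t * (√((s - ρ) ^ 2 + t ^ 2))⁻¹ := by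
      rw [intervalIntegral.integral_of_le hb0, integral_Ioc_eq_integral_Ioo,
        ← integral_indicator measurableSet_Ioi, ← integral_indicator measurableSet_Ioo]
      congr 1
      ext t
      by_cases ht : 0 < t
      · have : s ^ 2 + t ^ 2 < R ^ 2 ↔ t < b := by
          rw [← pow_lt_pow_iff_left₀ ht.le hb0 two_ne_zero, hb2]
          constructor <;> intro h <;> linarith
        simp [Set.indicator, ht, this]
      · simp [Set.indicator, ht]
    rw [this, integral_mul_inv_sqrt_sq_add_sq hb0, hb2]
    have : (s - ρ) ^ 2 + (R ^ 2 - s ^ 2) = R ^ 2 + ρ ^ 2 - 2 * ρ * s := by ring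
    rw [this]
    push_cast
    ring
  · rw [Set.indicator_of_notMem hs]
    have : ∀ t : ℝ, ¬ (s ^ 2 + t ^ 2 < R ^ 2) := by
      intro t ht
      exact hs (abs_lt.1 (abs_lt_of_sq_lt_sq (by nlinarith [sq_nonneg t]) hR.le))
    simp [this]

theorem integral_abs_sub_of_le {ρ R : ℝ} (hR : 0 ≤ R) (h0 : 0 ≤ ρ) (h : ρ ≤ R) :
    ∫ s in (-R)..R, |s - ρ| = R ^ 2 + ρ ^ 2 := by
  have hi : ∀ a b : ℝ, IntervalIntegrable (fun s : ℝ => |s - ρ|) volume a b :=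
    fun a b => Continuous.intervalIntegrable (by fun_prop) a b
  rw [← intervalIntegral.integral_add_adjacent_intervals (hi (-R) ρ) (hi ρ R)]
  have h1 : ∫ s in (-R)..ρ, |s - ρ| = ∫ s in (-R)..ρ, (ρ - s) := by
    refine intervalIntegral.integral_congr fun s hs => ?_
    rw [Set.uIcc_of_le (by linarith)] at hs
    rw [abs_of_nonpos (by linarith [hs.2])]
    ring
  have h2 : ∫ s in ρ..R, |s - ρ| = ∫ s in ρ..R, (s - ρ) := by
    refine intervalIntegral.integral_congr fun s hs => ?_
    rw [Set.uIcc_of_le h] at hs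
    rw [abs_of_nonneg (by linarith [hs.1])]
  rw [h1, h2, intervalIntegral.integral_sub (by simp) (by simp),
    intervalIntegral.integral_sub (by simp) (by simp)]
  simp
  ring

theorem integral_abs_sub_of_ge {ρ R : ℝ} (hR : 0 ≤ R) (h : R ≤ ρ) :
    ∫ s in (-R)..R, |s - ρ| = 2 * R * ρ := by
  have h1 : ∫ s in (-R)..R, |s - ρ| = ∫ s in (-R)..R, (ρ - s) := by
    refine intervalIntegral.integral_congr fun s hs => ?_
    rw [Set.uIcc_of_le (by linarith)] at hs
    rw [abs_of_nonpos (by linarith [hs.2])]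
    ring
  rw [h1, intervalIntegral.integral_sub (by simp) (by simp)]
  simp only [intervalIntegral.integral_const, integral_id, smul_eq_mul]
  ring

theorem integral_sqrt_sq_add_sq_sub {ρ R : ℝ} (hR : 0 < R) (h0 : 0 < ρ) :
    ∫ s in (-R)..R, √(R ^ 2 + ρ ^ 2 - 2 * ρ * s) =
      ((R + ρ) ^ 3 - |R - ρ| ^ 3) / (3 * ρ) := by
  have hderiv : ∀ s ∈ Set.uIcc (-R) R,
      HasDerivAt (fun s : ℝ => -(R ^ 2 + ρ ^ 2 - 2 * ρ * s) ^ (3 / 2 : ℝ) / (3 * ρ))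
        (√(R ^ 2 + ρ ^ 2 - 2 * ρ * s)) s := by
    intro s _
    have h := (((hasDerivAt_id s).const_mul (2 * ρ)).const_sub (R ^ 2 + ρ ^ 2)).rpow_const
      (p := 3 / 2) (Or.inr (by norm_num))
    refine (h.neg.div_const (3 * ρ)).congr_deriv ?_
    rw [Real.sqrt_eq_rpow, id]
    norm_num
    field_simp
  rw [intervalIntegral.integral_eq_sub_of_hasDerivAt hderiv
    (Continuous.intervalIntegrable (by fun_prop) _ _)]
  have h1 : R ^ 2 + ρ ^ 2 - 2 * ρ * R = |R - ρ| ^ (2 : ℝ) := by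
    rw [Real.rpow_two, sq_abs]; ring
  have h2 : R ^ 2 + ρ ^ 2 - 2 * ρ * -R = (R + ρ) ^ (2 : ℝ) := by
    rw [Real.rpow_two]; ring
  rw [h1, h2, ← Real.rpow_mul (abs_nonneg _), ← Real.rpow_mul (by positivity)]
  norm_num
  ring

theorem exists_isometry_map_eq (y : E3) :
    ∃ T : E3 ≃ₗᵢ[ℝ] WithLp 2 (ℝ × EuclideanSpace ℝ (Fin 2)), T y = WithLp.toLp 2 (‖y‖, 0) := by
  have hfin : Module.finrank ℝ E3 =
      Module.finrank ℝ (WithLp 2 (ℝ × EuclideanSpace ℝ (Fin 2))) := by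
    rw [(WithLp.linearEquiv 2 ℝ (ℝ × EuclideanSpace ℝ (Fin 2))).finrank_eq]
    simp
  let L : E3 ≃ₗᵢ[ℝ] WithLp 2 (ℝ × EuclideanSpace ℝ (Fin 2)) :=
    ((stdOrthonormalBasis ℝ _).reindex (finCongr (by rw [← hfin]; simp))).repr.symm
  refine ⟨L.trans (Submodule.reflection (ℝ ∙ (L y - WithLp.toLp 2 (‖y‖, 0)))ᗮ), ?_⟩
  rw [LinearIsometryEquiv.trans_apply]
  refine Submodule.reflection_sub ?_
  rw [L.norm_map, WithLp.prod_norm_eq_of_L2]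
  simp

theorem locallyIntegrable_inv_norm : LocallyIntegrable (fun x : E3 => ‖x‖⁻¹) volume := by
  refine locallyIntegrable_of_norm_le_rpow (C := 1) (α := 1) (by simp) (by simp) ?_
    (by fun_prop)
  filter_upwards with x
  simp [Real.rpow_neg_one]

theorem integrableOn_inv_norm_sub_ball (c y : E3) (R : ℝ) :
    IntegrableOn (fun x : E3 => ‖x - y‖⁻¹) (Metric.ball c R) := by
  have h : IntegrableOn (fun x : E3 => ‖x‖⁻¹) (Metric.ball (c - y) R) :=
    (locallyIntegrable_inv_norm.integrableOn_isCompact (isCompact_closedBall (c - y) R)).mono_set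
      Metric.ball_subset_closedBall
  have hmp := measurePreserving_sub_right (volume : Measure E3) y
  have := (hmp.integrableOn_comp_preimage (MeasurableEquiv.subRight y).measurableEmbedding).2 h
  have hpre : (fun x => x - y) ⁻¹' Metric.ball (c - y) R = Metric.ball c R := by
    ext x
    simp
  rwa [hpre] at this

theorem integral_ball_inv_norm_sub_eq_integral_slices (y : E3) {R : ℝ} (hR : 0 < R) :
    ∫ x in Metric.ball (0 : E3) R, ‖x - y‖⁻¹ =
      2 * π * ∫ s in (-R)..R, (√(R ^ 2 + ‖y‖ ^ 2 - 2 * ‖y‖ * s) - |s - ‖y‖|) := by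
  obtain ⟨T, hT⟩ := exists_isometry_map_eq y
  let e : E3 ≃ᵐ ℝ × EuclideanSpace ℝ (Fin 2) :=
    T.toHomeomorph.toMeasurableEquiv.trans (MeasurableEquiv.toLp 2 _).symm
  have he : MeasurePreserving e :=
    (WithLp.volume_preserving_ofLp (U := ℝ) (V := EuclideanSpace ℝ (Fin 2))).comp
      T.measurePreserving
  let g : ℝ × EuclideanSpace ℝ (Fin 2) → ℝ := fun p =>
    if p.1 ^ 2 + ‖p.2‖ ^ 2 < R ^ 2 then (√((p.1 - ‖y‖) ^ 2 + ‖p.2‖ ^ 2))⁻¹ else 0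
  have hg : (fun x => g (e x)) = (Metric.ball (0 : E3) R).indicator fun x => ‖x - y‖⁻¹ := by
    ext x
    have h1 : ‖x‖ ^ 2 = (e x).1 ^ 2 + ‖(e x).2‖ ^ 2 := by
      rw [← T.norm_map x, WithLp.prod_norm_sq_eq_of_L2, Real.norm_eq_abs, sq_abs]
      rfl
    have h2 : ‖x - y‖ = √(((e x).1 - ‖y‖) ^ 2 + ‖(e x).2‖ ^ 2) := by
      rw [← T.norm_map, map_sub, hT, WithLp.prod_norm_eq_of_L2, Real.norm_eq_abs, sq_abs]
      congr 2
      simp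
      rfl
    have h3 : x ∈ Metric.ball (0 : E3) R ↔ (e x).1 ^ 2 + ‖(e x).2‖ ^ 2 < R ^ 2 := by
      rw [mem_ball_zero_iff, ← h1, pow_lt_pow_iff_left₀ (norm_nonneg _) hR.le two_ne_zero]
    simp only [g, Set.indicator, h3, h2]
  have hint : Integrable g := by
    rw [← he.integrable_comp_emb e.measurableEmbedding]
    change Integrable (fun x => g (e x))
    rw [hg, integrable_indicator_iff measurableSet_ball]
    exact integrableOn_inv_norm_sub_ball 0 y R
  rw [← integral_indicator measurableSet_ball, ← hg, he.integral_comp e.measurableEmbedding g]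
  rw [Measure.volume_eq_prod, integral_prod _ hint]
  simp only [g, integral_disc_inv_sqrt _ _ hR]
  rw [integral_indicator measurableSet_Ioo, ← integral_Ioc_eq_integral_Ioo,
    ← intervalIntegral.integral_of_le (by linarith), intervalIntegral.integral_const_mul]

theorem integral_ball_inv_norm_sub_of_le (y : E3) {R : ℝ} (hR : 0 < R) (hy : ‖y‖ ≤ R) :
    ∫ x in Metric.ball (0 : E3) R, ‖x - y‖⁻¹ = 4 * π * (R ^ 2 / 2 - ‖y‖ ^ 2 / 6) := by
  rw [integral_ball_inv_norm_sub_eq_integral_slices y hR, intervalIntegral.integral_sub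
    (Continuous.intervalIntegrable (by fun_prop) _ _)
    (Continuous.intervalIntegrable (by fun_prop) _ _),
    integral_abs_sub_of_le hR.le (norm_nonneg y) hy]
  rcases (norm_nonneg y).eq_or_lt with h0 | h0
  · simp [← h0, Real.sqrt_sq hR.le]
    ring
  · rw [integral_sqrt_sq_add_sq_sub hR h0, abs_of_nonneg (by linarith)]
    field_simp
    ring

theorem integral_ball_inv_norm_sub_of_ge (y : E3) {R : ℝ} (hR : 0 < R) (hy : R ≤ ‖y‖) :
    ∫ x in Metric.ball (0 : E3) R, ‖x - y‖⁻¹ = 4 * π * (R ^ 3 / (3 * ‖y‖)) := by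
  have h0 : 0 < ‖y‖ := hR.trans_le hy
  rw [integral_ball_inv_norm_sub_eq_integral_slices y hR, intervalIntegral.integral_sub
    (Continuous.intervalIntegrable (by fun_prop) _ _)
    (Continuous.intervalIntegrable (by fun_prop) _ _),
    integral_abs_sub_of_ge hR.le hy, integral_sqrt_sq_add_sq_sub hR h0,
    abs_of_nonpos (by linarith)]
  field_simp
  ring

theorem coul_eq (x y : E3) : coul x y = (4 * π)⁻¹ * ‖y - x‖⁻¹ := by
  rw [coul, one_div, mul_inv, norm_sub_rev]

theorem coul_comm (x y : E3) : coul x y = coul y x := by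
  rw [coul, coul, norm_sub_rev]

theorem coul_nonneg (x y : E3) : 0 ≤ coul x y := by
  rw [coul]
  positivity

theorem coul_le {x y : E3} {r : ℝ} (hr : 0 < r) (h : r ≤ ‖x - y‖) : coul x y ≤ 1 / (4 * π * r) := by
  have := pi_pos
  rw [coul]
  gcongr

theorem measurable_coul : Measurable fun p : E3 × E3 => coul p.1 p.2 := by
  unfold coul
  fun_prop

theorem measurable_coul_left (x : E3) : Measurable (coul x) := by
  unfold coul
  fun_prop

/-- The Coulomb potential of a uniform unit charge density on `S`. -/
def coulPot (S : Set E3) (x : E3) : ℝ := ∫ y in S, coul x y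

theorem coulPot_nonneg (S : Set E3) (x : E3) : 0 ≤ coulPot S x :=
  integral_nonneg fun y => coul_nonneg x y

theorem integrableOn_coul_ball (c x : E3) (R : ℝ) : IntegrableOn (coul x) (Metric.ball c R) := by
  simp only [funext (coul_eq x)]
  exact (integrableOn_inv_norm_sub_ball c x R).const_mul _

theorem coulPot_ball_eq (c x : E3) (R : ℝ) :
    coulPot (Metric.ball c R) x =
      (4 * π)⁻¹ * ∫ y in Metric.ball (0 : E3) R, ‖y - (x - c)‖⁻¹ := by
  have hpre : (fun y => y - c) ⁻¹' Metric.ball (0 : E3) R = Metric.ball c R := by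
    ext y
    simp [dist_eq_norm]
  rw [← (measurePreserving_sub_right (volume : Measure E3) c).setIntegral_preimage_emb
    (MeasurableEquiv.subRight c).measurableEmbedding, hpre, ← integral_const_mul]
  simp only [coulPot, coul_eq, sub_sub_sub_cancel_right]

theorem coulPot_ball_of_le {c x : E3} {R : ℝ} (hR : 0 < R) (h : ‖x - c‖ ≤ R) :
    coulPot (Metric.ball c R) x = R ^ 2 / 2 - ‖x - c‖ ^ 2 / 6 := by
  rw [coulPot_ball_eq, integral_ball_inv_norm_sub_of_le _ hR h]
  field_simp

theorem coulPot_ball_of_ge {c x : E3} {R : ℝ} (hR : 0 < R) (h : R ≤ ‖x - c‖) :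
    coulPot (Metric.ball c R) x = R ^ 3 / (3 * ‖x - c‖) := by
  rw [coulPot_ball_eq, integral_ball_inv_norm_sub_of_ge _ hR h]
  field_simp

theorem coulPot_ball_le (c x : E3) {R : ℝ} (hR : 0 < R) :
    coulPot (Metric.ball c R) x ≤ R ^ 2 / 2 := by
  rcases le_total ‖x - c‖ R with h | h
  · rw [coulPot_ball_of_le hR h]
    linarith [sq_nonneg ‖x - c‖]
  · rw [coulPot_ball_of_ge hR h, div_le_div_iff₀ (by linarith) two_pos]
    nlinarith [mul_le_mul_of_nonneg_left h (sq_nonneg R), pow_pos hR 3]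

theorem integrableOn_coul {S : Set E3} (hS : MeasurableSet S) (hfin : volume S < ⊤) (x : E3) :
    IntegrableOn (coul x) S := by
  have hfar : IntegrableOn (coul x) (S \ Metric.ball x 1) := by
    refine Measure.integrableOn_of_bounded (M := 1 / (4 * π * 1))
      ((measure_mono Set.sdiff_subset).trans_lt hfin).ne
      (measurable_coul_left x).aestronglyMeasurable ?_
    filter_upwards [ae_restrict_mem (hS.diff measurableSet_ball)] with y hy
    rw [Real.norm_of_nonneg (coul_nonneg x y)]
    refine coul_le one_pos ?_
    have := hy.2
    rwa [Metric.mem_ball, not_lt, dist_comm, dist_eq_norm] at this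
  refine ((integrableOn_coul_ball x x 1).union hfar).mono_set fun y hy => ?_
  by_cases h : y ∈ Metric.ball x 1
  · exact Or.inl h
  · exact Or.inr ⟨hy, h⟩

theorem coulPot_mono {S T : Set E3} (hT : MeasurableSet T) (hfin : volume T < ⊤) (h : S ⊆ T)
    (x : E3) : coulPot S x ≤ coulPot T x :=
  setIntegral_mono_set (integrableOn_coul hT hfin x)
    (Filter.Eventually.of_forall fun y => coul_nonneg x y) h.eventuallyLE

theorem coulPot_union {S T : Set E3} (hS : MeasurableSet S) (hSfin : volume S < ⊤)
    (hT : MeasurableSet T) (hTfin : volume T < ⊤) (h : Disjoint S T) (x : E3) :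
    coulPot (S ∪ T) x = coulPot S x + coulPot T x :=
  setIntegral_union h hT (integrableOn_coul hS hSfin x) (integrableOn_coul hT hTfin x)

theorem coulPot_congr {S T : Set E3} (h : S =ᵐ[volume] T) : coulPot S = coulPot T := by
  ext x
  exact setIntegral_congr_set h

theorem coulPot_le_of_forall_le {S : Set E3} (hS : MeasurableSet S) (hfin : volume S < ⊤) {x : E3}
    {r : ℝ} (hr : 0 < r) (h : ∀ y ∈ S, r ≤ ‖x - y‖) :
    coulPot S x ≤ (volume S).toReal / (4 * π * r) := by
  calc coulPot S x ≤ ∫ _ in S, 1 / (4 * π * r) :=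
        setIntegral_mono_on (integrableOn_coul hS hfin x) (integrableOn_const hfin.ne) hS
          fun y hy => coul_le hr (h y hy)
    _ = (volume S).toReal / (4 * π * r) := by
        rw [setIntegral_const, smul_eq_mul, mul_one_div]
        rfl

theorem coulPot_le {S : Set E3} (hS : MeasurableSet S) (hfin : volume S < ⊤) (x : E3) :
    coulPot S x ≤ 1 / 2 + (volume S).toReal / (4 * π * 1) := by
  have hdf : volume (S \ Metric.ball x 1) < ⊤ := (measure_mono Set.sdiff_subset).trans_lt hfin
  have hif : volume (S ∩ Metric.ball x 1) < ⊤ := (measure_mono Set.inter_subset_left).trans_lt hfin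
  have hd := hS.diff (measurableSet_ball (x := x) (ε := 1))
  rw [← Set.inter_union_sdiff S (Metric.ball x 1), coulPot_union (hS.inter measurableSet_ball) hif
    hd hdf Set.disjoint_sdiff_inter.symm, Set.inter_union_sdiff]
  refine add_le_add ((coulPot_mono measurableSet_ball measure_ball_lt_top
    Set.inter_subset_right x).trans ((coulPot_ball_le x x one_pos).trans (by norm_num))) ?_
  refine (coulPot_le_of_forall_le hd hdf one_pos fun y hy => ?_).trans ?_
  · have := hy.2
    rwa [Metric.mem_ball, not_lt, dist_comm, dist_eq_norm] at this
  · have := pi_pos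
    gcongr
    · exact hfin.ne
    · exact Set.sdiff_subset

theorem continuous_integral_inv_max {S : Set E3} (hfin : volume S < ⊤) {η : ℝ}
    (hη : 0 < η) : Continuous fun x : E3 => ∫ y in S, 1 / (4 * π * max ‖x - y‖ η) := by
  have hπ := pi_pos
  have hne : ∀ x y : E3, 4 * π * max ‖x - y‖ η ≠ 0 := fun x y =>
    (mul_pos (by positivity) (lt_max_of_lt_right hη)).ne'
  refine continuous_of_dominated (bound := fun _ => 1 / (4 * π * η)) (fun x => ?_) (fun x => ?_)
    (integrableOn_const hfin.ne) (Filter.Eventually.of_forall fun y => ?_)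
  · exact Measurable.aestronglyMeasurable (by fun_prop)
  · refine Filter.Eventually.of_forall fun y => ?_
    have : 0 < max ‖x - y‖ η := lt_max_of_lt_right hη
    rw [Real.norm_of_nonneg (by positivity)]
    gcongr
    exact le_max_right _ _
  · exact continuous_const.div (by fun_prop) fun x => hne x y

theorem continuous_coulPot {S : Set E3} (hS : MeasurableSet S) (hfin : volume S < ⊤) :
    Continuous (coulPot S) := by
  have hπ := pi_pos
  refine continuous_of_uniform_approx_of_continuous fun u hu => ?_
  obtain ⟨ε, hε, hu⟩ := Metric.mem_uniformity_dist.1 hu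
  set η := min 1 ε with hη_def
  have hη : 0 < η := lt_min one_pos hε
  refine ⟨_, continuous_integral_inv_max hfin hη, fun x => hu ?_⟩
  have hint : IntegrableOn (fun y : E3 => 1 / (4 * π * max ‖x - y‖ η)) S := by
    refine Measure.integrableOn_of_bounded (M := 1 / (4 * π * η)) hfin.ne
      (Measurable.aestronglyMeasurable (by fun_prop)) (Filter.Eventually.of_forall fun y => ?_)
    have : 0 < max ‖x - y‖ η := lt_max_of_lt_right hη
    rw [Real.norm_of_nonneg (by positivity)]
    gcongr
    exact le_max_right _ _
  have hball := (integrable_indicator_iff measurableSet_ball).2 (integrableOn_coul_ball x x η)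
  calc dist (coulPot S x) (∫ y in S, 1 / (4 * π * max ‖x - y‖ η))
      = ‖∫ y in S, (coul x y - 1 / (4 * π * max ‖x - y‖ η))‖ := by
        rw [integral_sub (integrableOn_coul hS hfin x) hint, dist_eq_norm]
        rfl
    _ ≤ ∫ y in S, (Metric.ball x η).indicator (coul x) y := by
        refine norm_integral_le_of_norm_le hball.integrableOn ?_
        filter_upwards [ae_restrict_of_ae (compl_mem_ae_iff.2 (measure_singleton x))] with y hyx
        by_cases hy : y ∈ Metric.ball x η
        · have hxy : 0 < ‖x - y‖ := norm_sub_pos_iff.2 fun h => hyx h.symm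
          have h0 : 0 ≤ 1 / (4 * π * max ‖x - y‖ η) := by positivity
          have h1 : 1 / (4 * π * max ‖x - y‖ η) ≤ coul x y := by
            rw [coul]
            gcongr
            exact le_max_left _ _
          rw [Set.indicator_of_mem hy, Real.norm_of_nonneg (by linarith)]
          linarith
        · rw [Set.indicator_of_notMem hy]
          rw [Metric.mem_ball, not_lt, dist_comm, dist_eq_norm] at hy
          rw [max_eq_left hy, coul, sub_self, norm_zero]
    _ ≤ ∫ y, (Metric.ball x η).indicator (coul x) y :=
        setIntegral_le_integral hball (Filter.Eventually.of_forall fun y =>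
          Set.indicator_nonneg (fun y _ => coul_nonneg x y) y)
    _ = coulPot (Metric.ball x η) x := integral_indicator measurableSet_ball
    _ ≤ η ^ 2 / 2 := coulPot_ball_le x x hη
    _ < ε := by nlinarith [min_le_left 1 ε, min_le_right 1 ε]

theorem Continuous.integrableOn_ball {f : E3 → ℝ} (hf : Continuous f) (x : E3) (ε : ℝ) :
    IntegrableOn f (Metric.ball x ε) :=
  (hf.continuousOn.integrableOn_compact (isCompact_closedBall x ε)).mono_set
    Metric.ball_subset_closedBall

theorem integrable_coul_prod {A S : Set E3} (hAfin : volume A < ⊤)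
    (hS : MeasurableSet S) (hSfin : volume S < ⊤) :
    Integrable (fun p : E3 × E3 => coul p.1 p.2)
      ((volume.restrict A).prod (volume.restrict S)) := by
  rw [integrable_prod_iff measurable_coul.aestronglyMeasurable]
  refine ⟨Filter.Eventually.of_forall fun x => integrableOn_coul hS hSfin x, ?_⟩
  simp only [Real.norm_of_nonneg (coul_nonneg _ _)]
  refine Measure.integrableOn_of_bounded (M := 1 / 2 + (volume S).toReal / (4 * π * 1)) hAfin.ne
    (continuous_coulPot hS hSfin).aestronglyMeasurable (Filter.Eventually.of_forall fun x => ?_)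
  rw [← coulPot, Real.norm_of_nonneg (coulPot_nonneg S x)]
  exact coulPot_le hS hSfin x

theorem integrableOn_coulPot {A S : Set E3} (hAfin : volume A < ⊤)
    (hS : MeasurableSet S) (hSfin : volume S < ⊤) : IntegrableOn (coulPot S) A :=
  (integrable_coul_prod hAfin hS hSfin).integral_prod_left

theorem setIntegral_coulPot_comm {A S : Set E3} (hAfin : volume A < ⊤)
    (hS : MeasurableSet S) (hSfin : volume S < ⊤) :
    ∫ x in A, coulPot S x = ∫ y in S, coulPot A y := by
  have h := integral_integral_swap (f := fun x y => coul x y)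
    (integrable_coul_prod hAfin hS hSfin)
  simp only [coulPot]
  rw [h]
  simp only [coul_comm]

theorem potential_eq {Ωp Ωm : Set E3} (hp : MeasurableSet Ωp) (hpfin : volume Ωp < ⊤)
    (hm : MeasurableSet Ωm) (hmfin : volume Ωm < ⊤) (x : E3) :
    potential Ωp Ωm x = coulPot Ωp x - coulPot Ωm x := by
  have h : ∀ y, (Set.indicator Ωp (fun _ => (1 : ℝ)) y - Set.indicator Ωm (fun _ => (1 : ℝ)) y) *
      coul x y = Set.indicator Ωp (coul x) y - Set.indicator Ωm (coul x) y := by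
    intro y
    by_cases h1 : y ∈ Ωp <;> by_cases h2 : y ∈ Ωm <;> simp [h1, h2]
  simp only [potential, h]
  rw [integral_sub ((integrable_indicator_iff hp).2 (integrableOn_coul hp hpfin x))
    ((integrable_indicator_iff hm).2 (integrableOn_coul hm hmfin x)), integral_indicator hp,
    integral_indicator hm]
  rfl

theorem energy_union {Ωp Ωm A : Set E3} (hp : MeasurableSet Ωp) (hpfin : volume Ωp < ⊤)
    (hm : MeasurableSet Ωm) (hmfin : volume Ωm < ⊤) (hA : MeasurableSet A)
    (hAfin : volume A < ⊤) (hd : Disjoint Ωm A) :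
    energy Ωp (Ωm ∪ A) =
      energy Ωp Ωm + ∫ x in A, (coulPot A x - 2 * potential Ωp Ωm x) := by
  have hU := coulPot_union hm hmfin hA hAfin hd
  have hI : ∀ {B S : Set E3}, volume B < ⊤ → MeasurableSet S → volume S < ⊤ →
    IntegrableOn (coulPot S) B := fun h1 h2 h3 => integrableOn_coulPot h1 h2 h3
  simp only [energy, potential_eq hp hpfin hm hmfin]
  change (∫ x in Ωp, coulPot Ωp x) + (∫ x in Ωm ∪ A, coulPot (Ωm ∪ A) x) -
      2 * (∫ x in Ωp, coulPot (Ωm ∪ A) x) =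
    (∫ x in Ωp, coulPot Ωp x) + (∫ x in Ωm, coulPot Ωm x) - 2 * (∫ x in Ωp, coulPot Ωm x) + _
  have hadd : ∀ {B : Set E3}, volume B < ⊤ →
      IntegrableOn (fun x => coulPot Ωm x + coulPot A x) B :=
    fun h => (hI h hm hmfin).add (hI h hA hAfin)
  have hsub : IntegrableOn (fun x => coulPot Ωp x - coulPot Ωm x) A :=
    (hI hAfin hp hpfin).sub (hI hAfin hm hmfin)
  have hsub : IntegrableOn (fun x => coulPot Ωp x - coulPot Ωm x) A :=
    (hI hAfin hp hpfin).sub (hI hAfin hm hmfin)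
  simp only [hU]
  rw [setIntegral_union hd hA (hadd hmfin) (hadd hAfin),
    integral_add (hI hmfin hm hmfin) (hI hmfin hA hAfin),
    integral_add (hI hAfin hm hmfin) (hI hAfin hA hAfin),
    integral_add (hI hpfin hm hmfin) (hI hpfin hA hAfin),
    integral_sub (hI hAfin hA hAfin) (hsub.const_mul 2),
    integral_const_mul, integral_sub (hI hAfin hp hpfin) (hI hAfin hm hmfin),
    setIntegral_coulPot_comm hmfin hA hAfin, setIntegral_coulPot_comm hpfin hA hAfin]
  ring

theorem continuous_potential {Ωp Ωm : Set E3} (hp : MeasurableSet Ωp) (hpfin : volume Ωp < ⊤)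
    (hm : MeasurableSet Ωm) (hmfin : volume Ωm < ⊤) : Continuous (potential Ωp Ωm) := by
  rw [funext (potential_eq hp hpfin hm hmfin)]
  exact (continuous_coulPot hp hpfin).sub (continuous_coulPot hm hmfin)

/-- Where the potential of a minimizer is positive, the minimizer fills the space locally. -/
theorem exists_ball_subset_ae_minimizer {Ωp Ωm : Set E3} (hp : MeasurableSet Ωp)
    (hpfin : volume Ωp < ⊤) (hadm : Adm Ωp Ωm)
    (hmin : ∀ A, Adm Ωp A → energy Ωp Ωm ≤ energy Ωp A) {x : E3}
    (hx : 0 < potential Ωp Ωm x) (hxp : x ∉ closure Ωp) :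
    ∃ ε > 0, Disjoint (Metric.ball x ε) Ωp ∧ volume (Metric.ball x ε \ Ωm) = 0 := by
  obtain ⟨hm, hdisj, hmfin⟩ := hadm
  have hcont := continuous_potential hp hpfin hm hmfin
  set c := potential Ωp Ωm x / 2 with hc
  have hopen : {z | c < potential Ωp Ωm z} ∩ (closure Ωp)ᶜ ∈ nhds x :=
    ((isOpen_lt continuous_const hcont).inter isClosed_closure.isOpen_compl).mem_nhds
      ⟨show c < potential Ωp Ωm x by linarith, hxp⟩
  obtain ⟨δ, hδ, hball⟩ := Metric.mem_nhds_iff.1 hopen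
  set ε := min δ (min 1 c) with hε_def
  have hε : 0 < ε := lt_min hδ (lt_min one_pos (by linarith))
  have hεδ : ε ≤ δ := min_le_left _ _
  have hε1 : ε ≤ 1 := (min_le_right _ _).trans (min_le_left _ _)
  have hεc : ε ≤ c := (min_le_right _ _).trans (min_le_right _ _)
  have hd : Disjoint (Metric.ball x ε) Ωp := Set.disjoint_left.2 fun z hz hzp =>
    (hball (Metric.ball_subset_ball hεδ hz)).2 (subset_closure hzp)
  refine ⟨ε, hε, hd, ?_⟩
  set A := Metric.ball x ε \ Ωm with hA_def
  have hA : MeasurableSet A := measurableSet_ball.diff hm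
  have hAfin : volume A < ⊤ := (measure_mono Set.sdiff_subset).trans_lt measure_ball_lt_top
  have hpA : Ωp ∩ A = ∅ :=
    Set.disjoint_iff_inter_eq_empty.1 (hd.symm.mono_right Set.sdiff_subset)
  have hle := hmin (Ωm ∪ A) ⟨hm.union hA, by rwa [Set.inter_union_distrib_left, hpA,
    Set.union_empty], measure_union_lt_top hmfin hAfin⟩
  rw [energy_union hp hpfin hm hmfin hA hAfin Set.disjoint_sdiff_right] at hle
  have hbound : ∫ z in A, (coulPot A z - 2 * potential Ωp Ωm z) ≤ ∫ _ in A, -c := by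
    refine setIntegral_mono_on ((integrableOn_coulPot hAfin hA hAfin).sub
      (Integrable.const_mul ?_ 2)) (integrableOn_const hAfin.ne) hA fun z hz => ?_
    · rw [funext (potential_eq hp hpfin hm hmfin)]
      exact (integrableOn_coulPot hAfin hp hpfin).sub (integrableOn_coulPot hAfin hm hmfin)
    · have h1 : c < potential Ωp Ωm z := (hball (Metric.ball_subset_ball hεδ hz.1)).1
      have h2 : coulPot A z ≤ ε ^ 2 / 2 :=
        (coulPot_mono measurableSet_ball measure_ball_lt_top Set.sdiff_subset z).trans
          (coulPot_ball_le x z hε)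
      nlinarith
  rw [setIntegral_const, smul_eq_mul] at hbound
  have hc0 : 0 < c := by linarith
  have hreal : volume.real A = 0 := le_antisymm (by nlinarith) measureReal_nonneg
  exact (measureReal_eq_zero_iff hAfin.ne).1 hreal

theorem volume_ball_mul_coul {x y : E3} {ε : ℝ} (hε : 0 < ε) :
    volume.real (Metric.ball x ε) * coul x y = ε ^ 3 / (3 * ‖y - x‖) := by
  rw [coul_eq, Measure.real, EuclideanSpace.volume_ball_fin_three]
  have := pi_pos
  rw [← ENNReal.ofReal_pow hε.le, ← ENNReal.ofReal_mul (by positivity),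
    ENNReal.toReal_ofReal (by positivity)]
  field_simp

/-- The mean value property for the potential of charges lying outside a ball. -/
theorem setIntegral_ball_coulPot_of_disjoint {S : Set E3} (hS : MeasurableSet S)
    (hSfin : volume S < ⊤) {x : E3} {ε : ℝ} (hε : 0 < ε) (h : Disjoint (Metric.ball x ε) S) :
    ∫ z in Metric.ball x ε, coulPot S z = volume.real (Metric.ball x ε) * coulPot S x := by
  rw [setIntegral_coulPot_comm measure_ball_lt_top hS hSfin, coulPot, ← integral_const_mul]
  refine setIntegral_congr_fun hS fun y hy => ?_
  have hy' := Set.disjoint_right.1 h hy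
  rw [Metric.mem_ball, not_lt, dist_eq_norm] at hy'
  rw [coulPot_ball_of_ge hε hy', volume_ball_mul_coul hε]

theorem setIntegral_ball_coulPot_self (x : E3) {ε : ℝ} (hε : 0 < ε) :
    ∫ z in Metric.ball x ε, coulPot (Metric.ball x ε) z =
      volume.real (Metric.ball x ε) * coulPot (Metric.ball x ε) x -
        (∫ z in Metric.ball x ε, ‖z - x‖ ^ 2) / 6 := by
  have hcongr : ∫ z in Metric.ball x ε, coulPot (Metric.ball x ε) z =
      ∫ z in Metric.ball x ε, (ε ^ 2 / 2 - ‖z - x‖ ^ 2 / 6) := by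
    refine setIntegral_congr_fun measurableSet_ball fun z hz => ?_
    rw [Metric.mem_ball, dist_eq_norm] at hz
    exact coulPot_ball_of_le hε hz.le
  have hcont : Continuous fun z : E3 => ‖z - x‖ ^ 2 / 6 := by fun_prop
  rw [hcongr, integral_sub (continuous_const.integrableOn_ball x ε) (hcont.integrableOn_ball x ε),
    setIntegral_const,
    integral_div, coulPot_ball_of_le hε (by simpa using hε.le)]
  simp

theorem setIntegral_ball_potential {Ωp Ωm : Set E3} (hp : MeasurableSet Ωp)
    (hpfin : volume Ωp < ⊤) (hm : MeasurableSet Ωm) (hmfin : volume Ωm < ⊤) {x : E3} {ε : ℝ}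
    (hε : 0 < ε) (hd : Disjoint (Metric.ball x ε) Ωp) (hfull : volume (Metric.ball x ε \ Ωm) = 0) :
    ∫ z in Metric.ball x ε, potential Ωp Ωm z =
      volume.real (Metric.ball x ε) * potential Ωp Ωm x +
        (∫ z in Metric.ball x ε, ‖z - x‖ ^ 2) / 6 := by
  set B := Metric.ball x ε with hB_def
  have hBfin : volume B < ⊤ := measure_ball_lt_top
  have hB : MeasurableSet B := measurableSet_ball
  have hm' : MeasurableSet (Ωm \ B) := hm.diff hB
  have hm'fin : volume (Ωm \ B) < ⊤ := (measure_mono Set.sdiff_subset).trans_lt hmfin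
  have hae : Ωm =ᵐ[volume] (Ωm \ B ∪ B : Set E3) := by
    rw [Set.sdiff_union_self, ae_eq_set, Set.sdiff_eq_empty.2 Set.subset_union_left,
      Set.union_sdiff_left]
    exact ⟨measure_empty, hfull⟩
  have hsplit : ∀ z, coulPot Ωm z = coulPot (Ωm \ B) z + coulPot B z := fun z => by
    rw [coulPot_congr hae, coulPot_union hm' hm'fin hB hBfin Set.disjoint_sdiff_left]
  have hadd : IntegrableOn (fun z => coulPot (Ωm \ B) z + coulPot B z) B :=
    (integrableOn_coulPot hBfin hm' hm'fin).add (integrableOn_coulPot hBfin hB hBfin)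
  simp only [potential_eq hp hpfin hm hmfin, hsplit]
  rw [integral_sub (integrableOn_coulPot hBfin hp hpfin) hadd,
    integral_add (integrableOn_coulPot hBfin hm' hm'fin) (integrableOn_coulPot hBfin hB hBfin),
    setIntegral_ball_coulPot_of_disjoint hp hpfin hε hd,
    setIntegral_ball_coulPot_of_disjoint hm' hm'fin hε Set.disjoint_sdiff_right,
    setIntegral_ball_coulPot_self x hε]
  ring

theorem setIntegral_ball_inner_sub (x v : E3) (ε : ℝ) :
    ∫ z in Metric.ball x ε, ⟪z - x, v⟫ = 0 := by
  set f : E3 → ℝ := (Metric.ball x ε).indicator fun z => ⟪z - x, v⟫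
  have hodd : ∀ z, f (x + x - z) = -f z := by
    intro z
    have h1 : x + x - z - x = -(z - x) := by abel
    have h2 : x + x - z ∈ Metric.ball x ε ↔ z ∈ Metric.ball x ε := by
      rw [Metric.mem_ball, Metric.mem_ball, dist_eq_norm, dist_eq_norm, h1, norm_neg]
    by_cases hz : z ∈ Metric.ball x ε
    · simp only [f, Set.indicator_of_mem hz, Set.indicator_of_mem (h2.2 hz), h1, inner_neg_left]
    · simp only [f, Set.indicator_of_notMem hz, Set.indicator_of_notMem (mt h2.1 hz), neg_zero]
  have h := integral_sub_left_eq_self f volume (x + x)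
  simp only [hodd, integral_neg] at h
  rw [← integral_indicator measurableSet_ball]
  change ∫ z, f z = 0
  linarith

theorem setIntegral_ball_norm_sub_sq_pos (x : E3) {ε : ℝ} (hε : 0 < ε) :
    0 < ∫ z in Metric.ball x ε, ‖z - x‖ ^ 2 := by
  have hcont : Continuous fun z : E3 => ‖z - x‖ ^ 2 := by fun_prop
  rw [setIntegral_pos_iff_support_of_nonneg_ae
    (Filter.Eventually.of_forall fun z => sq_nonneg ‖z - x‖)
    (hcont.integrableOn_ball x ε)]
  have hsupp : Function.support (fun z : E3 => ‖z - x‖ ^ 2) ∩ Metric.ball x ε =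
      Metric.ball x ε \ {x} := by
    ext z
    simp [sub_eq_zero, and_comm]
  rw [hsupp, measure_sdiff_null (measure_singleton x)]
  exact Metric.measure_ball_pos volume x hε

theorem setIntegral_ball_norm_sub_sq (x x₀ : E3) (ε : ℝ) :
    ∫ z in Metric.ball x ε, ‖z - x₀‖ ^ 2 =
      (∫ z in Metric.ball x ε, ‖z - x‖ ^ 2) +
        volume.real (Metric.ball x ε) * ‖x - x₀‖ ^ 2 := by
  have hI : ∀ f : E3 → ℝ, Continuous f → IntegrableOn f (Metric.ball x ε) := fun f hf =>
    hf.integrableOn_ball x ε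
  have h : ∀ z : E3, ‖z - x₀‖ ^ 2 = ‖z - x‖ ^ 2 + 2 * ⟪z - x, x - x₀⟫ + ‖x - x₀‖ ^ 2 := by
    intro z
    rw [← norm_add_sq_real, sub_add_sub_cancel]
  rw [integral_congr_ae (Filter.Eventually.of_forall h), integral_add (hI _ (by fun_prop)) (hI _ (by fun_prop)),
    integral_add (hI _ (by fun_prop)) (hI _ (by fun_prop)), integral_const_mul,
    setIntegral_ball_inner_sub, setIntegral_const]
  simp

/-- Nondegeneracy: around a point where the potential is positive it grows quadratically. -/
theorem exists_sphere_sq_lt_potential {Ωp Ωm : Set E3} (hp : MeasurableSet Ωp)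
    (hpfin : volume Ωp < ⊤) (hadm : Adm Ωp Ωm)
    (hmin : ∀ A, Adm Ωp A → energy Ωp Ωm ≤ energy Ωp A) {x₀ : E3}
    (hx₀ : 0 < potential Ωp Ωm x₀) {r : ℝ} (hr : 0 < r)
    (hd : Disjoint (Metric.closedBall x₀ r) (closure Ωp)) :
    ∃ y, ‖y - x₀‖ = r ∧ r ^ 2 / 12 < potential Ωp Ωm y := by
  obtain ⟨hm, -, hmfin⟩ := id hadm
  have hcont := continuous_potential hp hpfin hm hmfin
  obtain ⟨y, hy, hmax⟩ := (isCompact_closedBall x₀ r).exists_isMaxOn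
    ⟨x₀, Metric.mem_closedBall_self hr.le⟩
    (f := fun z => potential Ωp Ωm z - ‖z - x₀‖ ^ 2 / 12) (by fun_prop)
  have hval : potential Ωp Ωm x₀ ≤ potential Ωp Ωm y - ‖y - x₀‖ ^ 2 / 12 := by
    simpa using hmax (Metric.mem_closedBall_self hr.le)
  have hy' : ‖y - x₀‖ ≤ r := by rwa [Metric.mem_closedBall, dist_eq_norm] at hy
  rcases hy'.eq_or_lt with heq | hlt
  · exact ⟨y, heq, by rw [heq] at hval; linarith⟩
  exfalso
  obtain ⟨δ, hδ, hdδ, hfull⟩ := exists_ball_subset_ae_minimizer hp hpfin hadm hmin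
    (by nlinarith [sq_nonneg ‖y - x₀‖] : 0 < potential Ωp Ωm y) (Set.disjoint_left.1 hd hy)
  set ε := min δ (r - ‖y - x₀‖) with hε_def
  have hε : 0 < ε := lt_min hδ (by linarith)
  have hsub : Metric.ball y ε ⊆ Metric.ball y δ := Metric.ball_subset_ball (min_le_left _ _)
  have hmean := setIntegral_ball_potential hp hpfin hm hmfin hε (hdδ.mono_left hsub)
    (measure_mono_null (Set.sdiff_subset_sdiff_left hsub) hfull)
  have hpos := setIntegral_ball_norm_sub_sq_pos y hε
  have hsq := setIntegral_ball_norm_sub_sq y x₀ ε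
  have hI : ∀ f : E3 → ℝ, Continuous f → IntegrableOn f (Metric.ball y ε) := fun f hf =>
    hf.integrableOn_ball y ε
  have hle : ∫ z in Metric.ball y ε, (potential Ωp Ωm z - ‖z - x₀‖ ^ 2 / 12) ≤
      ∫ _ in Metric.ball y ε, (potential Ωp Ωm y - ‖y - x₀‖ ^ 2 / 12) := by
    refine setIntegral_mono_on (hI _ (by fun_prop)) (hI _ (by fun_prop)) measurableSet_ball
      fun z hz => hmax ?_
    rw [Metric.mem_ball] at hz
    rw [Metric.mem_closedBall]
    have := dist_triangle z y x₀
    have h2 : ε ≤ r - ‖y - x₀‖ := min_le_right _ _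
    rw [dist_eq_norm y x₀] at this
    linarith
  rw [integral_sub (hI _ hcont) (hI _ (by fun_prop)), integral_div, hmean, hsq,
    setIntegral_const, smul_eq_mul] at hle
  nlinarith

/-- **Theorem 2.4(1)**: every point of the open representative
`Ω⁻ = {φ > 0} \ closure Ω⁺` of the minimizer is at distance at most
`2 |Ω⁺|^{1/3}` from `Ω⁺`. -/
theorem minimizer_distance_bound
    (Ωp : Set E3) (ho : IsOpen Ωp) (hb : Bornology.IsBounded Ωp)
    (hlip : HasLipschitzBoundary Ωp)
    (Ωm : Set E3) (hadm : Adm Ωp Ωm)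
    (hmin : ∀ A, Adm Ωp A → energy Ωp Ωm ≤ energy Ωp A) :
    ∀ x ∈ {x | 0 < potential Ωp Ωm x} \ closure Ωp,
      Metric.infDist x Ωp ≤ 2 * (volume Ωp).toReal ^ ((1:ℝ)/3) := by
  rintro x₀ ⟨hx₀, hx₀p⟩
  have hp : MeasurableSet Ωp := ho.measurableSet
  have hpfin : volume Ωp < ⊤ := hb.measure_lt_top
  set V := (volume Ωp).toReal with hV_def
  have hV : 0 ≤ V := ENNReal.toReal_nonneg
  set d := Metric.infDist x₀ Ωp with hd_def
  by_contra! hlt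
  have hVd : 8 * V < d ^ 3 := by
    have h := pow_lt_pow_left₀ hlt (by positivity) three_ne_zero
    rwa [mul_pow, ← Real.rpow_natCast (V ^ _), ← Real.rpow_mul hV, show
      (1 : ℝ) / 3 * (3 : ℕ) = 1 by norm_num, Real.rpow_one, show (2 : ℝ) ^ 3 = 8 by norm_num] at h
  have hd : 0 < d := lt_of_le_of_lt (by positivity) hlt
  have hdist : ∀ y ∈ closure Ωp, d ≤ dist x₀ y := fun y hy => by
    rw [hd_def, ← Metric.infDist_closure]
    exact Metric.infDist_le_dist_of_mem hy
  have hdisj : Disjoint (Metric.closedBall x₀ (d / 2)) (closure Ωp) :=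
    Set.disjoint_left.2 fun y hy hyp => by
      have := hdist y hyp
      rw [Metric.mem_closedBall, dist_comm] at hy
      linarith
  obtain ⟨y, hy, hφ⟩ := exists_sphere_sq_lt_potential hp hpfin hadm hmin hx₀ (half_pos hd) hdisj
  rw [potential_eq hp hpfin hadm.1 hadm.2.2] at hφ
  have hupper : coulPot Ωp y ≤ V / (4 * π * (d / 2)) :=
    coulPot_le_of_forall_le hp hpfin (half_pos hd) fun z hz => by
      have h1 := hdist z (subset_closure hz)
      have h2 := dist_triangle x₀ y z
      rw [dist_comm x₀ y, dist_eq_norm y x₀, hy, dist_eq_norm y z] at h2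
      linarith
  have hlast : (d / 2) ^ 2 / 12 < V / (4 * π * (d / 2)) := by
    linarith [coulPot_nonneg Ωm y]
  have hπ := pi_gt_three
  rw [lt_div_iff₀ (by positivity)] at hlast
  nlinarith [pow_pos hd 3, mul_lt_mul_of_pos_right hπ (pow_pos hd 3)]
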